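/- Let A ⊆ [n] with |A| = k odd, and let ψ ∈ ℂ^{2^n} be a unit vector which is a pseudo-stabilizer state at A. Then ⟨ψ, ((I − H_A)/2) ψ⟩ ≥ sin²(π/8), where H_A is the 2^n×2^n matrix whose j-th Kronecker factor is the Hadamard matrix for j∈A and the identity for j∉A. -/

import Mathlib

open Matrix

noncomputable section

/-- The space of `n`-qubit operators (2^n × 2^n complex matrices, indexed by bit strings). -/
abbrev QMat (n : ℕ) := Matrix (Fin n → Fin 2) (Fin n → Fin 2) ℂ

/-- The space of `n`-qubit state vectors (ℂ^{2^n}, indexed by bit strings). -/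
abbrev QVec (n : ℕ) := (Fin n → Fin 2) → ℂ

def PauliX : Matrix (Fin 2) (Fin 2) ℂ := !![0, 1; 1, 0]
def PauliY : Matrix (Fin 2) (Fin 2) ℂ := !![0, -Complex.I; Complex.I, 0]
def PauliZ : Matrix (Fin 2) (Fin 2) ℂ := !![1, 0; 0, -1]

/-- `Q` is one of the four single-qubit Pauli matrices `I, X, Y, Z`. -/
def IsSingleQubitPauli (Q : Matrix (Fin 2) (Fin 2) ℂ) : Prop :=
  Q = 1 ∨ Q = PauliX ∨ Q = PauliY ∨ Q = PauliZ

/-- Kronecker product, in qubit order, of `n` single-qubit operators. -/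
def tensorn (n : ℕ) (Q : Fin n → Matrix (Fin 2) (Fin 2) ℂ) : QMat n :=
  fun x y => ∏ j, Q j (x j) (y j)

/-- `P` is an element of the `n`-qubit Pauli group: `P = i^ℓ · Q_1 ⊗ ⋯ ⊗ Q_n`. -/
def IsPauli {n : ℕ} (P : QMat n) : Prop :=
  ∃ (ℓ : Fin 4) (Q : Fin n → Matrix (Fin 2) (Fin 2) ℂ),
    (∀ j, IsSingleQubitPauli (Q j)) ∧ P = (Complex.I ^ (ℓ : ℕ)) • tensorn n Q

/-- The Hadamard matrix `H = (1/√2)[[1,1],[1,-1]]`. -/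
def Had2 : Matrix (Fin 2) (Fin 2) ℂ := ((Real.sqrt 2 : ℂ))⁻¹ • !![1, 1; 1, -1]

/-- `H_A`: Hadamard on every qubit in `A`, identity elsewhere. -/
def HadOn {n : ℕ} (A : Finset (Fin n)) : QMat n :=
  tensorn n (fun j => if j ∈ A then Had2 else 1)

lemma tensorn_one (n : ℕ) : tensorn n (fun _ => (1 : Matrix (Fin 2) (Fin 2) ℂ)) = 1 := by
  ext x y
  by_cases h : x = y
  · subst h
    simp [tensorn, Matrix.one_apply]
  · have hj : ∃ j, x j ≠ y j := by
      by_contra hc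
      push_neg at hc
      exact h (funext hc)
    obtain ⟨j, hj⟩ := hj
    rw [tensorn, Matrix.one_apply]
    rw [if_neg h]
    exact Finset.prod_eq_zero (Finset.mem_univ j) (by simp [Matrix.one_apply, hj])

lemma tensorn_mul {n : ℕ} (Q R : Fin n → Matrix (Fin 2) (Fin 2) ℂ) :
    tensorn n Q * tensorn n R = tensorn n (fun j => Q j * R j) := by
  ext x y
  simp only [tensorn, Matrix.mul_apply]
  rw [Finset.prod_univ_sum (fun _ => (Finset.univ : Finset (Fin 2)))
    (fun j b => Q j (x j) b * R j b (y j))]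
  rw [Fintype.piFinset_univ]
  exact Finset.sum_congr rfl fun z _ => (Finset.prod_mul_distrib).symm

lemma IsSingleQubitPauli.mul_self {Q : Matrix (Fin 2) (Fin 2) ℂ}
    (h : IsSingleQubitPauli Q) : Q * Q = 1 := by
  rcases h with h | h | h | h <;> subst h
  · simp
  · rw [PauliX, Matrix.mul_fin_two, Matrix.one_fin_two]; norm_num
  · rw [PauliY, Matrix.mul_fin_two, Matrix.one_fin_two]; norm_num [Complex.I_mul_I]
  · rw [PauliZ, Matrix.mul_fin_two, Matrix.one_fin_two]; norm_num

/-- The invertible `n`-qubit operators. -/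
abbrev MatU (n : ℕ) := (QMat n)ˣ

/-- The `n`-qubit Pauli group, as a subgroup of the invertible 2^n × 2^n matrices. -/
def PauliGrp (n : ℕ) : Subgroup (MatU n) :=
  Subgroup.closure {u : MatU n | IsPauli (u : QMat n)}

/-- The matrix `i·I` as a unit. -/
def phaseUnit (n : ℕ) : MatU n :=
  Units.map (algebraMap ℂ (QMat n)).toMonoidHom (Units.mk0 Complex.I Complex.I_ne_zero)

lemma phaseUnit_isPauli (n : ℕ) : IsPauli ((phaseUnit n : MatU n) : QMat n) := by
  refine ⟨1, fun _ => 1, fun _ => Or.inl rfl, ?_⟩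
  rw [tensorn_one]
  show algebraMap ℂ (QMat n) Complex.I = _
  rw [Algebra.algebraMap_eq_smul_one]
  norm_num

lemma phaseUnit_mem (n : ℕ) : phaseUnit n ∈ PauliGrp n :=
  Subgroup.subset_closure (phaseUnit_isPauli n)

def phaseElt (n : ℕ) : ↥(PauliGrp n) := ⟨phaseUnit n, phaseUnit_mem n⟩

/-- The subgroup `⟨iI⟩` of the Pauli group. -/
def phaseSub (n : ℕ) : Subgroup ↥(PauliGrp n) := Subgroup.zpowers (phaseElt n)

lemma phaseUnit_comm {n : ℕ} (g : MatU n) : g * phaseUnit n = phaseUnit n * g := by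
  refine Units.ext ?_
  show (g : QMat n) * (algebraMap ℂ (QMat n) Complex.I) =
    (algebraMap ℂ (QMat n) Complex.I) * (g : QMat n)
  exact (Algebra.commutes Complex.I (g : QMat n)).symm

instance phaseSub_normal (n : ℕ) : (phaseSub n).Normal := by
  constructor
  intro h hmem g
  obtain ⟨k, hk⟩ := Subgroup.mem_zpowers_iff.mp hmem
  have hc0 : Commute g (phaseElt n) := Subtype.ext (phaseUnit_comm (g : MatU n))
  have hc : Commute g h := hk ▸ hc0.zpow_right k
  have hgh : g * h * g⁻¹ = h := by
    rw [hc.eq, mul_assoc, mul_inv_cancel, mul_one]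
  rw [hgh]
  exact hmem

/-- The phase-less Pauli group `P̂_n = P_n / ⟨iI⟩`. -/
abbrev PhaselessPauli (n : ℕ) := ↥(PauliGrp n) ⧸ phaseSub n

/-- Two phase-less Pauli operators commute if (any, equivalently every, pair of)
representatives commute as matrices. -/
def PCommute {n : ℕ} (x y : PhaselessPauli n) : Prop :=
  ∃ P Q : ↥(PauliGrp n), QuotientGroup.mk P = x ∧ QuotientGroup.mk Q = y ∧
    ((P : MatU n) : QMat n) * ((Q : MatU n) : QMat n) =
      ((Q : MatU n) : QMat n) * ((P : MatU n) : QMat n)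

/-- A commuting subgroup of the phase-less Pauli group `P̂_n`: all pairs of elements
commute. -/
def IsCommutingSubgroup {n : ℕ} (M : Subgroup (PhaselessPauli n)) : Prop :=
  ∀ x ∈ M, ∀ y ∈ M, PCommute x y

/-- The tensor factors of a Pauli matrix (junk value otherwise); for a Pauli matrix the
decomposition `P = i^ℓ · Q_1 ⊗ ⋯ ⊗ Q_n` is unique. -/
def pauliFactor {n : ℕ} (P : QMat n) : Fin n → Matrix (Fin 2) (Fin 2) ℂ :=
  @dite _ (IsPauli P) (Classical.dec _) (fun h => h.choose_spec.choose) (fun _ => fun _ => 1)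

lemma pauliFactor_single {n : ℕ} (P : QMat n) (j : Fin n) :
    IsSingleQubitPauli (pauliFactor P j) := by
  rw [pauliFactor]
  split
  · next h => exact h.choose_spec.choose_spec.1 j
  · exact Or.inl rfl

/-- The matrix representing the local view `ρ_A(P)`: the tensor factors of `P` on `A`,
identity elsewhere (and no phase). -/
def maskMat {n : ℕ} (A : Finset (Fin n)) (P : QMat n) : QMat n :=
  tensorn n (fun j => if j ∈ A then pauliFactor P j else 1)

lemma maskMat_isPauli {n : ℕ} (A : Finset (Fin n)) (P : QMat n) : IsPauli (maskMat A P) := by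
  refine ⟨0, fun j => if j ∈ A then pauliFactor P j else 1, ?_, ?_⟩
  · intro j
    by_cases h : j ∈ A
    · simpa [h] using pauliFactor_single P j
    · simp [h, IsSingleQubitPauli]
  · simp [maskMat]

lemma maskMat_mul_self {n : ℕ} (A : Finset (Fin n)) (P : QMat n) :
    maskMat A P * maskMat A P = 1 := by
  rw [maskMat, tensorn_mul]
  have h1 : (fun j => (if j ∈ A then pauliFactor P j else 1) *
      (if j ∈ A then pauliFactor P j else 1)) = fun _ : Fin n => (1 : Matrix (Fin 2) (Fin 2) ℂ) := by
    funext j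
    by_cases h : j ∈ A
    · simp only [h, if_true]
      exact (pauliFactor_single P j).mul_self
    · simp [h]
  rw [h1, tensorn_one]

/-- The local view `ρ_A(P)` as a unit. -/
def maskUnit {n : ℕ} (A : Finset (Fin n)) (P : QMat n) : MatU n :=
  ⟨maskMat A P, maskMat A P, maskMat_mul_self A P, maskMat_mul_self A P⟩

lemma maskUnit_mem {n : ℕ} (A : Finset (Fin n)) (P : QMat n) : maskUnit A P ∈ PauliGrp n :=
  Subgroup.subset_closure (maskMat_isPauli A P)

/-- The local view `ρ_A(P) ∈ P̂_n` of a Pauli operator `P` at `A ⊆ [n]`. -/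
def localView {n : ℕ} (A : Finset (Fin n)) (P : QMat n) : PhaselessPauli n :=
  QuotientGroup.mk (⟨maskUnit A P, maskUnit_mem A P⟩ : ↥(PauliGrp n))

/-- `S ⊆ P_n` is `A`-locally-commuting: its local view `ρ_A(S)` at `A` is a commuting
subgroup of `P̂_n`. -/
def IsLocallyCommuting {n : ℕ} (A : Finset (Fin n)) (S : Set (QMat n)) : Prop :=
  ∃ K : Subgroup (PhaselessPauli n), (K : Set (PhaselessPauli n)) = localView A '' S ∧
    IsCommutingSubgroup K

/-- The stabilizer group of a state: the Pauli operators fixing `ψ`. -/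
def stabSet {n : ℕ} (ψ : QVec n) : Set (QMat n) :=
  {P | IsPauli P ∧ P *ᵥ ψ = ψ}

/-- `ψ` is a pseudo-stabilizer state at `A`: some subset `S ⊆ stab(ψ)` is
`A`-locally-commuting and `ρ_A(S)` has maximal dimension `|A|`, i.e. `|ρ_A(S)| = 2^|A|`. -/
def IsPseudoStabilizerAt {n : ℕ} (ψ : QVec n) (A : Finset (Fin n)) : Prop :=
  ∃ S : Set (QMat n), S ⊆ stabSet ψ ∧ IsLocallyCommuting A S ∧
    Nat.card ↥(localView A '' S) = 2 ^ A.card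

section BinaryForms

open Module

/-- Over `𝔽₂`, a subspace and its orthogonal complement have complementary sizes. -/
lemma card_mul_card_orthogonal {V : Type*} [AddCommGroup V] [Module (ZMod 2) V] [Finite V]
    (B : LinearMap.BilinForm (ZMod 2) V) (hB : ∀ x, (∀ y, B x y = 0) → x = 0)
    (W : Submodule (ZMod 2) V) :
    Nat.card W * Nat.card (B.orthogonal W) = Nat.card V := by
  have hker : LinearMap.ker B = ⊥ := by
    rw [LinearMap.ker_eq_bot']
    exact fun x hx => hB x fun y => by rw [hx, LinearMap.zero_apply]
  have h := B.finrank_add_finrank_orthogonal' W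
  rw [hker, inf_bot_eq, finrank_bot, add_zero] at h
  rw [natCard_eq_pow_finrank (K := ZMod 2) (V := W),
    natCard_eq_pow_finrank (K := ZMod 2) (V := B.orthogonal W),
    natCard_eq_pow_finrank (K := ZMod 2) (V := V), ← pow_add, h]

/-- A self-orthogonal subspace of half dimension contains every vector orthogonal to it. -/
lemma mem_of_orthogonal_of_card_sq {V : Type*} [AddCommGroup V] [Module (ZMod 2) V] [Finite V]
    (B : LinearMap.BilinForm (ZMod 2) V) (hB : ∀ x, (∀ y, B x y = 0) → x = 0)
    (L : Submodule (ZMod 2) V) (hL : ∀ x ∈ L, ∀ y ∈ L, B x y = 0)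
    (hcard : Nat.card L * Nat.card L = Nat.card V) {v : V} (hv : ∀ x ∈ L, B x v = 0) :
    v ∈ L := by
  have hpos : 0 < Nat.card L := Nat.card_pos
  have h := card_mul_card_orthogonal B hB L
  rw [← hcard] at h
  have hle : L ≤ B.orthogonal L := fun y hy x hx => hL x hx y hy
  have heq : (L : Set V) = B.orthogonal L :=
    Set.eq_of_subset_of_ncard_le hle (Nat.eq_of_mul_eq_mul_left hpos h).le (Set.toFinite _)
  rw [← SetLike.mem_coe, heq]
  exact hv

/-- The dot product on `𝔽₂^ι`. -/
def dotForm (ι : Type*) [Fintype ι] : LinearMap.BilinForm (ZMod 2) (ι → ZMod 2) :=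
  LinearMap.mk₂ (ZMod 2) (fun x y => x ⬝ᵥ y) add_dotProduct smul_dotProduct dotProduct_add
    (fun c x y => dotProduct_smul c x y)

/-- For an even code `D` of odd length, `|D| · |D ∩ D^⊥|` is at most half the size of the
ambient space. -/
lemma two_mul_card_mul_card_radical_le {ι : Type*} [Fintype ι] (hodd : Odd (Fintype.card ι))
    (D : Submodule (ZMod 2) (ι → ZMod 2)) (hD : ∀ d ∈ D, ∑ j, d j = 0) :
    2 * (Nat.card D * Set.ncard {d | d ∈ D ∧ ∀ e ∈ D, e ⬝ᵥ d = 0}) ≤ 2 ^ Fintype.card ι := by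
  classical
  set E : Set (ι → ZMod 2) := {d | d ∈ D ∧ ∀ e ∈ D, e ⬝ᵥ d = 0} with hE
  have hcard := card_mul_card_orthogonal (dotForm ι)
    (fun x hx => dotProduct_eq_zero x hx) D
  rw [Nat.card_eq_fintype_card (α := ι → ZMod 2), Fintype.card_fun, ZMod.card] at hcard
  have hone : ∑ _j : ι, (1 : ZMod 2) = 1 := by
    simpa using (ZMod.natCast_eq_one_iff_odd).2 hodd
  have hdisj : Disjoint E ((fun d => 1 + d) '' E) := by
    rw [Set.disjoint_left]
    rintro _ hd ⟨d, hd', rfl⟩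
    have h1 : (1 : ι → ZMod 2) ∈ D := by simpa using D.sub_mem hd.1 hd'.1
    have := hD _ h1
    simp only [Pi.one_apply, hone] at this
    exact one_ne_zero this
  have hsub : E ∪ (fun d => 1 + d) '' E ⊆ ((dotForm ι).orthogonal D : Set (ι → ZMod 2)) := by
    rintro d (hd | ⟨d, hd, rfl⟩) e he
    · exact hd.2 e he
    · change e ⬝ᵥ (1 + d) = 0
      rw [dotProduct_add, hd.2 e he, dotProduct_one, hD e he, add_zero]
  have hle := Set.ncard_le_ncard hsub (Set.toFinite _)
  rw [Set.ncard_union_eq hdisj (Set.toFinite _) (Set.toFinite _),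
    Set.ncard_image_of_injective _ (add_right_injective _)] at hle
  rw [← hcard]
  have : 2 * E.ncard ≤ Nat.card ((dotForm ι).orthogonal D) := by
    rw [two_mul]; exact hle
  calc 2 * (Nat.card D * E.ncard) = Nat.card D * (2 * E.ncard) := by ring
    _ ≤ _ := Nat.mul_le_mul_left _ this

/-- The symplectic form on `(𝔽₂²)^ι`. -/
def sympForm (ι : Type*) [Fintype ι] : LinearMap.BilinForm (ZMod 2) (ι → ZMod 2 × ZMod 2) :=
  LinearMap.mk₂ (ZMod 2) (fun x y => ∑ j, ((x j).1 * (y j).2 + (x j).2 * (y j).1))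
    (fun x x' y => by
      rw [← Finset.sum_add_distrib]
      exact Finset.sum_congr rfl fun j _ => by
        simp only [Pi.add_apply, Prod.fst_add, Prod.snd_add]; ring)
    (fun c x y => by
      rw [Finset.smul_sum]
      exact Finset.sum_congr rfl fun j _ => by
        simp only [Pi.smul_apply, Prod.smul_fst, Prod.smul_snd, smul_eq_mul]; ring)
    (fun x y y' => by
      rw [← Finset.sum_add_distrib]
      exact Finset.sum_congr rfl fun j _ => by
        simp only [Pi.add_apply, Prod.fst_add, Prod.snd_add]; ring)
    (fun c x y => by
      rw [Finset.smul_sum]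
      exact Finset.sum_congr rfl fun j _ => by
        simp only [Pi.smul_apply, Prod.smul_fst, Prod.smul_snd, smul_eq_mul]; ring)

lemma sympForm_apply {ι : Type*} [Fintype ι] (x y : ι → ZMod 2 × ZMod 2) :
    sympForm ι x y = ∑ j, ((x j).1 * (y j).2 + (x j).2 * (y j).1) := rfl

lemma eq_zero_of_sympForm_eq_zero {ι : Type*} [Fintype ι] (x : ι → ZMod 2 × ZMod 2)
    (h : ∀ y, sympForm ι x y = 0) : x = 0 := by
  classical
  funext j
  have h1 := h (Pi.single j (0, 1))
  have h2 := h (Pi.single j (1, 0))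
  rw [sympForm_apply, Finset.sum_eq_single j (fun i _ hi => by simp [Pi.single_eq_of_ne hi])
    (by simp)] at h1 h2
  simp only [Pi.single_eq_same, mul_one, mul_zero, add_zero, zero_add] at h1 h2
  exact Prod.ext h1 h2

end BinaryForms

section PauliStrings

lemma eq_zero_or_one_of_zmod_two (a : ZMod 2) : a = 0 ∨ a = 1 := by
  revert a; decide

/-- The nontrivial additive character of `𝔽₂`. -/
def signChar : AddChar (ZMod 2) ℂ where
  toFun a := if a = 0 then 1 else -1
  map_zero_eq_one' := if_pos rfl
  map_add_eq_mul' a b := by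
    rcases eq_zero_or_one_of_zmod_two a with rfl | rfl <;>
      rcases eq_zero_or_one_of_zmod_two b with rfl | rfl <;>
      simp [show (1 + 1 : ZMod 2) = 0 from rfl]

@[simp] lemma signChar_one : signChar 1 = -1 := by
  change (if (1 : ZMod 2) = 0 then (1 : ℂ) else -1) = -1
  exact if_neg one_ne_zero

lemma signChar_sum {ι : Type*} (s : Finset ι) (f : ι → ZMod 2) :
    signChar (∑ j ∈ s, f j) = ∏ j ∈ s, signChar (f j) := by
  classical
  induction s using Finset.induction_on with
  | empty => simp
  | insert a s ha ih => rw [Finset.sum_insert ha, Finset.prod_insert ha, AddChar.map_add_eq_mul, ih]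

lemma norm_signChar (a : ZMod 2) : ‖signChar a‖ = 1 := by
  rcases eq_zero_or_one_of_zmod_two a with rfl | rfl <;> simp

lemma signChar_injective : Function.Injective signChar := by
  intro a b h
  rcases eq_zero_or_one_of_zmod_two a with rfl | rfl <;>
    rcases eq_zero_or_one_of_zmod_two b with rfl | rfl <;>
      first | rfl | norm_num at h

/-- The single-qubit Pauli matrix with label `(a, b)`, equal to `i^{ab} X^a Z^b`. -/
def pauliMat (p : ZMod 2 × ZMod 2) : Matrix (Fin 2) (Fin 2) ℂ :=
  if p.1 = 0 then (if p.2 = 0 then 1 else PauliZ) else if p.2 = 0 then PauliX else PauliY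

@[simp] lemma pauliMat_zero : pauliMat 0 = 1 := by simp [pauliMat]
lemma pauliMat_zero_zero : pauliMat (0, 0) = 1 := by simp [pauliMat]
lemma pauliMat_zero_one : pauliMat (0, 1) = PauliZ := by simp [pauliMat]
lemma pauliMat_one_zero : pauliMat (1, 0) = PauliX := by simp [pauliMat]
lemma pauliMat_one_one : pauliMat (1, 1) = PauliY := by simp [pauliMat]

lemma isSingleQubitPauli_pauliMat (p : ZMod 2 × ZMod 2) : IsSingleQubitPauli (pauliMat p) := by
  unfold pauliMat
  split_ifs
  exacts [Or.inl rfl, Or.inr (Or.inr (Or.inr rfl)), Or.inr (Or.inl rfl),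
    Or.inr (Or.inr (Or.inl rfl))]

lemma IsSingleQubitPauli.exists_label {Q : Matrix (Fin 2) (Fin 2) ℂ}
    (h : IsSingleQubitPauli Q) : ∃ p, pauliMat p = Q := by
  rcases h with rfl | rfl | rfl | rfl
  exacts [⟨_, pauliMat_zero_zero⟩, ⟨_, pauliMat_one_zero⟩, ⟨_, pauliMat_one_one⟩,
    ⟨_, pauliMat_zero_one⟩]

lemma pauliMat_conjTranspose (p : ZMod 2 × ZMod 2) : (pauliMat p)ᴴ = pauliMat p := by
  rcases isSingleQubitPauli_pauliMat p with h | h | h | h <;> rw [h]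
  · simp
  all_goals
    ext i j
    fin_cases i <;> fin_cases j <;> simp [PauliX, PauliY, PauliZ]

lemma pauliMat_mul_comm (p q : ZMod 2 × ZMod 2) :
    pauliMat p * pauliMat q =
      signChar (p.1 * q.2 + p.2 * q.1) • (pauliMat q * pauliMat p) := by
  obtain ⟨a, b⟩ := p
  obtain ⟨c, d⟩ := q
  rcases eq_zero_or_one_of_zmod_two a with rfl | rfl <;>
  rcases eq_zero_or_one_of_zmod_two b with rfl | rfl <;>
  rcases eq_zero_or_one_of_zmod_two c with rfl | rfl <;>
  rcases eq_zero_or_one_of_zmod_two d with rfl | rfl <;>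
  simp [pauliMat_zero_zero, pauliMat_zero_one, pauliMat_one_zero, pauliMat_one_one, PauliX,
    PauliY, PauliZ, show (1 + 1 : ZMod 2) = 0 from rfl]

lemma exists_pauliMat_mul (p q : ZMod 2 × ZMod 2) :
    ∃ m : ℕ, pauliMat p * pauliMat q = Complex.I ^ m • pauliMat (p + q) := by
  obtain ⟨a, b⟩ := p
  obtain ⟨c, d⟩ := q
  have h3 : Complex.I ^ 3 = -Complex.I := by rw [pow_succ, Complex.I_sq]; ring
  by_cases h : pauliMat (a, b) * pauliMat (c, d) = pauliMat ((a, b) + (c, d))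
  · exact ⟨0, by simpa using h⟩
  by_cases h' : pauliMat (a, b) * pauliMat (c, d) = Complex.I • pauliMat ((a, b) + (c, d))
  · exact ⟨1, by simpa using h'⟩
  refine ⟨3, ?_⟩
  rw [h3]
  revert h h'
  rcases eq_zero_or_one_of_zmod_two a with rfl | rfl <;>
  rcases eq_zero_or_one_of_zmod_two b with rfl | rfl <;>
  rcases eq_zero_or_one_of_zmod_two c with rfl | rfl <;>
  rcases eq_zero_or_one_of_zmod_two d with rfl | rfl <;>
  simp [pauliMat_zero_zero, pauliMat_zero_one, pauliMat_one_zero, pauliMat_one_one, PauliX,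
    PauliY, PauliZ, show (1 + 1 : ZMod 2) = 0 from rfl, Matrix.one_fin_two]

/-- The label of `X` (for `0`) or `Z` (for `1`). -/
def xzLabel (b : ZMod 2) : ZMod 2 × ZMod 2 := (1 + b, b)

lemma pauliMat_xzLabel_mul (b d : ZMod 2) :
    pauliMat (xzLabel b) * pauliMat (xzLabel (b + d)) =
      ((if d = 0 then 1 else -Complex.I) * signChar (b * d)) • pauliMat (d, d) := by
  rcases eq_zero_or_one_of_zmod_two b with rfl | rfl <;>
  rcases eq_zero_or_one_of_zmod_two d with rfl | rfl <;>
  simp [xzLabel, pauliMat_zero_zero, pauliMat_zero_one, pauliMat_one_zero, pauliMat_one_one,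
    PauliX, PauliY, PauliZ, show (1 + 1 : ZMod 2) = 0 from rfl, Matrix.one_fin_two]

lemma had2_eq_sum (x y : Fin 2) :
    Had2 x y = ∑ b : ZMod 2, (Real.sqrt 2 : ℂ)⁻¹ * pauliMat (xzLabel b) x y := by
  rw [show (Finset.univ : Finset (ZMod 2)) = {0, 1} from rfl, Finset.sum_pair (by decide)]
  fin_cases x <;> fin_cases y <;>
  simp [Had2, xzLabel, pauliMat_zero_one, pauliMat_one_zero, PauliX, PauliZ,
    show (1 + 1 : ZMod 2) = 0 from rfl]

lemma tensorn_smul {n : ℕ} (c : Fin n → ℂ) (Q : Fin n → Matrix (Fin 2) (Fin 2) ℂ) :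
    tensorn n (fun j => c j • Q j) = (∏ j, c j) • tensorn n Q := by
  ext x y
  simp [tensorn, Finset.prod_mul_distrib]

lemma tensorn_conjTranspose {n : ℕ} (Q : Fin n → Matrix (Fin 2) (Fin 2) ℂ) :
    (tensorn n Q)ᴴ = tensorn n (fun j => (Q j)ᴴ) := by
  ext x y
  simp [tensorn, conjTranspose_apply]

/-- The phase-free `n`-qubit Pauli operator with a given label. -/
def pauliString {n : ℕ} (u : Fin n → ZMod 2 × ZMod 2) : QMat n :=
  tensorn n (fun j => pauliMat (u j))

variable {n : ℕ}

lemma isPauli_pauliString (u : Fin n → ZMod 2 × ZMod 2) : IsPauli (pauliString u) :=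
  ⟨0, _, fun j => isSingleQubitPauli_pauliMat (u j), by simp [pauliString]⟩

lemma pauliString_zero : pauliString (0 : Fin n → ZMod 2 × ZMod 2) = 1 := by
  simp [pauliString, tensorn_one]

lemma pauliString_mul_self (u : Fin n → ZMod 2 × ZMod 2) :
    pauliString u * pauliString u = 1 := by
  rw [pauliString, tensorn_mul]
  simp only [(isSingleQubitPauli_pauliMat _).mul_self, tensorn_one]

lemma pauliString_conjTranspose (u : Fin n → ZMod 2 × ZMod 2) :
    (pauliString u)ᴴ = pauliString u := by
  simp only [pauliString, tensorn_conjTranspose, pauliMat_conjTranspose]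

lemma pauliString_mul_comm (u v : Fin n → ZMod 2 × ZMod 2) :
    pauliString u * pauliString v =
      signChar (sympForm (Fin n) u v) • (pauliString v * pauliString u) := by
  simp only [pauliString, tensorn_mul]
  rw [sympForm_apply, signChar_sum, ← tensorn_smul]
  simp only [← pauliMat_mul_comm]

lemma exists_pauliString_mul (u v : Fin n → ZMod 2 × ZMod 2) :
    ∃ m : ℕ, pauliString u * pauliString v = Complex.I ^ m • pauliString (u + v) := by
  choose m hm using exists_pauliMat_mul
  refine ⟨∑ j, m (u j) (v j), ?_⟩
  simp only [pauliString, tensorn_mul, hm, tensorn_smul, Finset.prod_pow_eq_pow_sum, Pi.add_apply]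

lemma pauliString_ne_zero (u : Fin n → ZMod 2 × ZMod 2) : pauliString u ≠ 0 := fun h => by
  have := pauliString_mul_self u
  rw [h, zero_mul] at this
  exact zero_ne_one this

/-- Pauli strings that are proportional to each other have the same label. -/
lemma eq_of_pauliString_eq_smul {u v : Fin n → ZMod 2 × ZMod 2} {c : ℂ}
    (h : pauliString v = c • pauliString u) : v = u := by
  rw [← sub_eq_zero]
  refine eq_zero_of_sympForm_eq_zero _ fun w => ?_
  rw [map_sub, LinearMap.sub_apply, sub_eq_zero]
  have hv := pauliString_mul_comm v w
  have hu : pauliString v * pauliString w =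
      signChar (sympForm (Fin n) u w) • (pauliString w * pauliString v) := by
    rw [h, smul_mul_assoc, pauliString_mul_comm u w, mul_smul_comm, smul_comm]
  have hne : pauliString w * pauliString v ≠ 0 := fun h0 => by
    apply pauliString_ne_zero v
    rw [← one_mul (pauliString v), ← pauliString_mul_self w, mul_assoc, h0, mul_zero]
  exact signChar_injective (smul_left_injective ℂ hne (hv.symm.trans hu))

end PauliStrings

section PhaselessLabels

variable {n : ℕ}

lemma coe_phaseElt_zpow (m : ℤ) :
    (((phaseElt n ^ m : ↥(PauliGrp n)) : MatU n) : QMat n) = Complex.I ^ m • 1 := by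
  change ((phaseUnit n ^ m : MatU n) : QMat n) = _
  rw [phaseUnit, ← map_zpow, Units.coe_map, ← Algebra.algebraMap_eq_smul_one]
  simp

/-- Representatives of the same phase-less Pauli operator are proportional. -/
lemma exists_smul_of_mk_eq {P Q : ↥(PauliGrp n)}
    (h : (QuotientGroup.mk P : PhaselessPauli n) = QuotientGroup.mk Q) :
    ∃ c : ℂ, ((Q : MatU n) : QMat n) = c • ((P : MatU n) : QMat n) := by
  obtain ⟨m, hm⟩ := Subgroup.mem_zpowers_iff.mp (QuotientGroup.eq.mp h)
  refine ⟨Complex.I ^ m, ?_⟩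
  have hQ : Q = P * phaseElt n ^ m := by rw [hm, mul_inv_cancel_left]
  rw [hQ, Subgroup.coe_mul, Units.val_mul, coe_phaseElt_zpow, mul_smul_comm, mul_one]

/-- A Pauli string as an element of the Pauli group. -/
def pauliStringElt (u : Fin n → ZMod 2 × ZMod 2) : ↥(PauliGrp n) :=
  ⟨⟨pauliString u, pauliString u, pauliString_mul_self u, pauliString_mul_self u⟩,
    Subgroup.subset_closure (isPauli_pauliString u)⟩

lemma coe_pauliStringElt (u : Fin n → ZMod 2 × ZMod 2) :
    ((pauliStringElt u : MatU n) : QMat n) = pauliString u := rfl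

/-- The phase-less Pauli operator with a given label. -/
def pauliClass (u : Fin n → ZMod 2 × ZMod 2) : PhaselessPauli n :=
  QuotientGroup.mk (pauliStringElt u)

lemma pauliClass_zero : pauliClass (0 : Fin n → ZMod 2 × ZMod 2) = 1 := by
  have : pauliStringElt (0 : Fin n → ZMod 2 × ZMod 2) = 1 :=
    Subtype.ext (Units.ext pauliString_zero)
  rw [pauliClass, this, QuotientGroup.mk_one]

lemma pauliClass_add (u v : Fin n → ZMod 2 × ZMod 2) :
    pauliClass (u + v) = pauliClass u * pauliClass v := by
  obtain ⟨m, hm⟩ := exists_pauliString_mul u v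
  rw [pauliClass, pauliClass, pauliClass, ← QuotientGroup.mk_mul, QuotientGroup.eq]
  have h : pauliStringElt u * pauliStringElt v =
      pauliStringElt (u + v) * phaseElt n ^ (m : ℤ) := by
    refine Subtype.ext (Units.ext ?_)
    rw [Subgroup.coe_mul, Units.val_mul, Subgroup.coe_mul, Units.val_mul, coe_phaseElt_zpow,
      mul_smul_comm, mul_one, zpow_natCast]
    exact hm
  rw [h, inv_mul_cancel_left]
  exact Subgroup.zpow_mem_zpowers _ _

lemma pauliClass_injective :
    Function.Injective (pauliClass : (Fin n → ZMod 2 × ZMod 2) → PhaselessPauli n) := by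
  intro u v h
  obtain ⟨c, hc⟩ := exists_smul_of_mk_eq h
  exact (eq_of_pauliString_eq_smul hc).symm

lemma sympForm_eq_zero_of_pCommute {u v : Fin n → ZMod 2 × ZMod 2}
    (h : PCommute (pauliClass u) (pauliClass v)) : sympForm (Fin n) u v = 0 := by
  obtain ⟨P, Q, hP, hQ, hPQ⟩ := h
  obtain ⟨c, hc⟩ := exists_smul_of_mk_eq hP
  obtain ⟨d, hd⟩ := exists_smul_of_mk_eq hQ
  rw [coe_pauliStringElt] at hc hd
  have hcomm : pauliString u * pauliString v = pauliString v * pauliString u := by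
    rw [hc, hd, smul_mul_smul_comm, smul_mul_smul_comm, hPQ, mul_comm c d]
  have hne : pauliString v * pauliString u ≠ 0 := fun h0 => by
    apply pauliString_ne_zero u
    rw [← one_mul (pauliString u), ← pauliString_mul_self v, mul_assoc, h0, mul_zero]
  have := (pauliString_mul_comm u v).symm.trans hcomm
  rw [← one_smul ℂ (pauliString v * pauliString u), smul_smul, mul_one] at this
  exact signChar_injective ((smul_left_injective ℂ hne this).trans signChar.map_zero_eq_one.symm)

/-- Extension of a label on `A` by the identity. -/
def extendLabel (A : Finset (Fin n)) (v : A → ZMod 2 × ZMod 2) : Fin n → ZMod 2 × ZMod 2 :=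
  fun j => if h : j ∈ A then v ⟨j, h⟩ else 0

lemma extendLabel_coe (A : Finset (Fin n)) (v : A → ZMod 2 × ZMod 2) (j : A) :
    extendLabel A v j = v j := by simp [extendLabel]

lemma extendLabel_of_notMem {A : Finset (Fin n)} (v : A → ZMod 2 × ZMod 2) {j : Fin n}
    (hj : j ∉ A) : extendLabel A v j = 0 := dif_neg hj

lemma extendLabel_zero (A : Finset (Fin n)) : extendLabel A 0 = 0 := by
  funext j
  simp [extendLabel]

lemma extendLabel_add (A : Finset (Fin n)) (v w : A → ZMod 2 × ZMod 2) :
    extendLabel A (v + w) = extendLabel A v + extendLabel A w := by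
  funext j
  by_cases h : j ∈ A <;> simp [extendLabel, h]

lemma extendLabel_injective (A : Finset (Fin n)) : Function.Injective (extendLabel A) := by
  intro v w h
  funext j
  rw [← extendLabel_coe A v, h, extendLabel_coe]

lemma sympForm_extendLabel (A : Finset (Fin n)) (u : Fin n → ZMod 2 × ZMod 2)
    (v : A → ZMod 2 × ZMod 2) :
    sympForm (Fin n) u (extendLabel A v) = sympForm A (fun j => u j) v := by
  rw [sympForm_apply, sympForm_apply, ← Finset.sum_subset (Finset.subset_univ A),
    ← Finset.sum_coe_sort A]
  · simp only [extendLabel_coe]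
  · intro j _ hj
    simp [extendLabel_of_notMem v hj]

/-- A Pauli operator is, up to phase, a Pauli string, whose label determines the local view. -/
lemma IsPauli.exists_label {P : QMat n} (hP : IsPauli P) (A : Finset (Fin n)) :
    ∃ (m : ℕ) (u : Fin n → ZMod 2 × ZMod 2), P = Complex.I ^ m • pauliString u ∧
      localView A P = pauliClass (extendLabel A fun j => u j) := by
  have hspec : ∃ m : Fin 4, P = (Complex.I ^ (m : ℕ)) • tensorn n (pauliFactor P) := by
    refine ⟨hP.choose, ?_⟩
    rw [pauliFactor, dif_pos hP]
    exact hP.choose_spec.choose_spec.2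
  obtain ⟨m, hm⟩ := hspec
  choose u hu using fun j => (pauliFactor_single P j).exists_label
  refine ⟨m, u, ?_, ?_⟩
  · rw [pauliString, funext hu]
    exact hm
  · rw [localView, pauliClass]
    congr 1
    refine Subtype.ext (Units.ext ?_)
    change tensorn n _ = tensorn n _
    congr 1
    funext j
    by_cases hj : j ∈ A <;> simp [hj, extendLabel, hu]

/-- A pseudo-stabilizer state at `A` provides a Lagrangian subspace of labels on `A`, each of
which extends to the label of a stabilizer. -/
lemma IsPseudoStabilizerAt.exists_lagrangian {ψ : QVec n} {A : Finset (Fin n)}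
    (h : IsPseudoStabilizerAt ψ A) :
    ∃ L : Submodule (ZMod 2) (A → ZMod 2 × ZMod 2),
      (∀ x ∈ L, ∀ y ∈ L, sympForm A x y = 0) ∧ Nat.card L = 2 ^ A.card ∧
      ∀ l ∈ L, ∃ (m : ℕ) (u : Fin n → ZMod 2 × ZMod 2), (fun j : A => u j) = l ∧
        (Complex.I ^ m • pauliString u) *ᵥ ψ = ψ := by
  obtain ⟨S, hS, ⟨K, hK, hcomm⟩, hcard⟩ := h
  let G : AddSubgroup (A → ZMod 2 × ZMod 2) :=
    { carrier := {v | pauliClass (extendLabel A v) ∈ K}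
      zero_mem' := by
        change pauliClass (extendLabel A 0) ∈ K
        rw [extendLabel_zero, pauliClass_zero]
        exact K.one_mem
      add_mem' := fun {v w} hv hw => by
        change pauliClass (extendLabel A (v + w)) ∈ K
        rw [extendLabel_add, pauliClass_add]
        exact K.mul_mem hv hw
      neg_mem' := fun {v} hv => by
        have hneg : -v = v := by
          funext j
          exact Prod.ext (ZMod.neg_eq_self_mod_two _) (ZMod.neg_eq_self_mod_two _)
        rwa [hneg] }
  have himage : ∀ l ∈ G, pauliClass (extendLabel A l) ∈ localView A '' S := fun l hl => by
    rw [← hK]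
    exact hl
  refine ⟨AddSubgroup.toZModSubmodule 2 G, fun x hx y hy => ?_, ?_, fun l hl => ?_⟩
  · have := sympForm_eq_zero_of_pCommute (hcomm _ hx _ hy)
    rw [sympForm_extendLabel] at this
    simpa only [extendLabel_coe] using this
  · rw [← hcard]
    refine Nat.card_congr (Equiv.ofBijective
      (fun l : G => (⟨_, himage l l.2⟩ : ↥(localView A '' S))) ⟨fun l l' hll => ?_, ?_⟩)
    · exact Subtype.ext (extendLabel_injective A
        (pauliClass_injective (congrArg Subtype.val hll)))
    · rintro ⟨x, P, hP, rfl⟩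
      obtain ⟨m, u, -, hu⟩ := (hS hP).1.exists_label A
      have hmem : (fun j : A => u j) ∈ G := by
        change pauliClass _ ∈ (K : Set (PhaselessPauli n))
        rw [hK, ← hu]
        exact ⟨P, hP, rfl⟩
      exact ⟨⟨_, hmem⟩, Subtype.ext hu.symm⟩
  · obtain ⟨P, hP, hPl⟩ := himage l hl
    obtain ⟨m, u, hPu, hu⟩ := (hS hP).1.exists_label A
    refine ⟨m, u, extendLabel_injective A (pauliClass_injective (hu.symm.trans hPl)), ?_⟩
    rw [← hPu]
    exact (hS hP).2

end PhaselessLabels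

section Expectation

variable {n : ℕ}

/-- The expectation value `⟨ψ, M ψ⟩`. -/
def expect (ψ : QVec n) (M : QMat n) : ℂ := star ψ ⬝ᵥ (M *ᵥ ψ)

lemma expect_smul (ψ : QVec n) (c : ℂ) (M : QMat n) : expect ψ (c • M) = c * expect ψ M := by
  rw [expect, smul_mulVec, dotProduct_smul, smul_eq_mul, expect]

lemma expect_sub (ψ : QVec n) (M N : QMat n) : expect ψ (M - N) = expect ψ M - expect ψ N := by
  rw [expect, sub_mulVec, dotProduct_sub, expect, expect]

lemma expect_sum {ι : Type*} (ψ : QVec n) (s : Finset ι) (M : ι → QMat n) :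
    expect ψ (∑ i ∈ s, M i) = ∑ i ∈ s, expect ψ (M i) := by
  simp only [expect, sum_mulVec, dotProduct_sum]

lemma expect_one {ψ : QVec n} (hψ : star ψ ⬝ᵥ ψ = 1) : expect ψ 1 = 1 := by
  rw [expect, one_mulVec, hψ]

lemma star_expect (ψ : QVec n) (M : QMat n) : star (expect ψ M) = expect ψ Mᴴ := by
  rw [expect, expect, star_dotProduct, star_mulVec, dotProduct_mulVec, star_star]

open scoped ComplexOrder in
/-- The variance of an observable in a unit state is nonnegative. -/
lemma norm_expect_sq_le {ψ : QVec n} (hψ : star ψ ⬝ᵥ ψ = 1) {M : QMat n} (hM : Mᴴ = M) :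
    ‖expect ψ M‖ ^ 2 ≤ (expect ψ (M * M)).re := by
  have hreal : star (expect ψ M) = expect ψ M := by rw [star_expect, hM]
  set t := expect ψ M with ht
  have h0 : 0 ≤ star ((M - t • 1) *ᵥ ψ) ⬝ᵥ ((M - t • 1) *ᵥ ψ) := dotProduct_star_self_nonneg _
  have h1 : star ((M - t • 1) *ᵥ ψ) ⬝ᵥ ((M - t • 1) *ᵥ ψ) = expect ψ (M * M) - t * t := by
    have hherm : (M - t • 1)ᴴ = M - t • 1 := by
      rw [conjTranspose_sub, conjTranspose_smul, conjTranspose_one, hM, hreal]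
    rw [star_mulVec, ← dotProduct_mulVec, mulVec_mulVec, hherm]
    change expect ψ _ = _
    have : (M - t • 1) * (M - t • 1) = M * M - t • M - t • (M - t • 1) := by
      rw [sub_mul, mul_sub, smul_mul_assoc, one_mul, mul_smul_comm, mul_one]
    rw [this, expect_sub, expect_sub, expect_smul, expect_smul, expect_sub, expect_smul,
      expect_one hψ, ← ht]
    ring
  rw [h1] at h0
  have h2 : t * t = ((‖t‖ ^ 2 : ℝ) : ℂ) := by
    nth_rewrite 1 [← hreal]
    rw [Complex.ofReal_pow]
    exact Complex.conj_mul' t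
  have h3 := (Complex.le_def.mp h0).1
  rw [h2, Complex.sub_re, Complex.ofReal_re, Complex.zero_re] at h3
  linarith

lemma norm_expect_pauliString_le {ψ : QVec n} (hψ : star ψ ⬝ᵥ ψ = 1)
    (u : Fin n → ZMod 2 × ZMod 2) : ‖expect ψ (pauliString u)‖ ≤ 1 := by
  have h := norm_expect_sq_le hψ (pauliString_conjTranspose u)
  rw [pauliString_mul_self, expect_one hψ, Complex.one_re] at h
  exact (sq_le_one_iff₀ (norm_nonneg _)).mp h

/-- A Pauli operator anticommuting with a stabilizer of `ψ` has vanishing expectation. -/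
lemma expect_pauliString_eq_zero {ψ : QVec n} {m : ℕ} {u w : Fin n → ZMod 2 × ZMod 2}
    (hu : (Complex.I ^ m • pauliString u) *ᵥ ψ = ψ) (huw : sympForm (Fin n) u w = 1) :
    expect ψ (pauliString w) = 0 := by
  set P := Complex.I ^ m • pauliString u with hP
  have hPP : Pᴴ * P = 1 := by
    have hI : star Complex.I * Complex.I = 1 := by simp
    rw [hP, conjTranspose_smul, pauliString_conjTranspose, smul_mul_smul_comm,
      pauliString_mul_self, star_pow, ← mul_pow, hI, one_pow, one_smul]
  have hadj : Pᴴ *ᵥ ψ = ψ := by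
    nth_rewrite 1 [← hu]
    rw [mulVec_mulVec, hPP, one_mulVec]
  have hanti : pauliString w * P = -(P * pauliString w) := by
    rw [hP, smul_mul_assoc, pauliString_mul_comm u w, huw, signChar_one, mul_smul_comm, neg_smul,
      one_smul, smul_neg, neg_neg]
  have h : expect ψ (pauliString w) = -expect ψ (pauliString w) := by
    calc expect ψ (pauliString w) = star ψ ⬝ᵥ (pauliString w *ᵥ (P *ᵥ ψ)) := by rw [hu, expect]
      _ = -(star ψ ⬝ᵥ (P *ᵥ (pauliString w *ᵥ ψ))) := by
        rw [mulVec_mulVec, hanti, neg_mulVec, dotProduct_neg, mulVec_mulVec]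
      _ = -(star (Pᴴ *ᵥ ψ) ⬝ᵥ (pauliString w *ᵥ ψ)) := by
        rw [star_mulVec, conjTranspose_conjTranspose, ← dotProduct_mulVec]
      _ = _ := by rw [hadj, expect]
  exact self_eq_neg.mp h

end Expectation

section HadamardExpansion

variable {n : ℕ} (A : Finset (Fin n))

/-- The string with `X` or `Z` on each qubit of `A`, as prescribed by `b`. -/
def xzString (b : A → ZMod 2) : QMat n := pauliString (extendLabel A fun j => xzLabel (b j))

lemma pauliString_extendLabel_apply (v : A → ZMod 2 × ZMod 2) (x y : Fin n → Fin 2) :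
    pauliString (extendLabel A v) x y =
      (∏ j : A, pauliMat (v j) (x j) (y j)) * ∏ j ∈ Aᶜ, (1 : Matrix _ _ ℂ) (x j) (y j) := by
  rw [pauliString, tensorn, ← Finset.prod_mul_prod_compl A, ← Finset.prod_coe_sort A]
  simp only [extendLabel_coe]
  congr 1
  refine Finset.prod_congr rfl fun j hj => ?_
  rw [extendLabel_of_notMem v (Finset.mem_compl.mp hj), pauliMat_zero]

lemma hadOn_eq_sum :
    HadOn A = (Real.sqrt 2 : ℂ)⁻¹ ^ A.card • ∑ b : A → ZMod 2, xzString A b := by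
  ext x y
  rw [Matrix.smul_apply, Matrix.sum_apply, smul_eq_mul]
  simp only [xzString, pauliString_extendLabel_apply]
  rw [← Finset.sum_mul, ← mul_assoc, HadOn, tensorn, ← Finset.prod_mul_prod_compl A]
  congr 1
  · rw [← Finset.prod_coe_sort A]
    simp only [Finset.coe_mem, if_true, had2_eq_sum]
    rw [Finset.prod_univ_sum, Fintype.piFinset_univ, Finset.mul_sum]
    refine Finset.sum_congr rfl fun b _ => ?_
    rw [Finset.prod_mul_distrib, Finset.prod_const, Finset.card_univ, Fintype.card_coe]
  · exact Finset.prod_congr rfl fun j hj => by rw [if_neg (Finset.mem_compl.mp hj)]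

lemma exists_xzString_mul (d : A → ZMod 2) :
    ∃ η : ℂ, ‖η‖ = 1 ∧ ∀ b, xzString A b * xzString A (b + d) =
      (η * signChar (b ⬝ᵥ d)) • pauliString (extendLabel A fun j => (d j, d j)) := by
  refine ⟨∏ j, if d j = 0 then 1 else -Complex.I, ?_, fun b => ?_⟩
  · rw [norm_prod]
    refine Finset.prod_eq_one fun j _ => ?_
    split_ifs <;> simp
  · have hsite : ∀ j : Fin n, pauliMat (extendLabel A (fun j => xzLabel (b j)) j) *
        pauliMat (extendLabel A (fun j => xzLabel ((b + d) j)) j) =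
        (if h : j ∈ A then (if d ⟨j, h⟩ = 0 then 1 else -Complex.I) *
          signChar (b ⟨j, h⟩ * d ⟨j, h⟩) else 1) •
        pauliMat (extendLabel A (fun j => (d j, d j)) j) := fun j => by
      by_cases h : j ∈ A
      · simp only [extendLabel, h, dif_pos, Pi.add_apply, pauliMat_xzLabel_mul]
      · simp [extendLabel, h]
    simp only [xzString, pauliString, tensorn_mul, hsite, tensorn_smul]
    congr 1
    rw [← Finset.prod_subset (Finset.subset_univ A), ← Finset.prod_coe_sort A, dotProduct,
      signChar_sum, ← Finset.prod_mul_distrib]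
    · exact Finset.prod_congr rfl fun j _ => by rw [dif_pos j.2]
    · intro j _ hj
      exact dif_neg hj

end HadamardExpansion

section EnergyBound

variable {n : ℕ} {A : Finset (Fin n)}

/-- A set invariant under translation by `e` has vanishing character sum at every vector not
orthogonal to `e`. -/
lemma sum_signChar_dotProduct_eq_zero {ι : Type*} [Fintype ι] {W : Finset (ι → ZMod 2)}
    {d e : ι → ZMod 2} (hW : ∀ b, b + e ∈ W ↔ b ∈ W) (hed : e ⬝ᵥ d ≠ 0) :
    ∑ b ∈ W, signChar (b ⬝ᵥ d) = 0 := by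
  have hed1 : e ⬝ᵥ d = 1 := (eq_zero_or_one_of_zmod_two _).resolve_left hed
  have h : ∑ b ∈ W, signChar (b ⬝ᵥ d) = ∑ b ∈ W, signChar ((b + e) ⬝ᵥ d) := by
    refine (Finset.sum_equiv (Equiv.addRight e) (fun b => ?_) fun b _ => rfl).symm
    exact (hW b).symm
  simp only [add_dotProduct, hed1, AddChar.map_add_eq_mul, signChar_one, mul_neg, mul_one,
    Finset.sum_neg_distrib] at h
  exact self_eq_neg.mp h

/-- The sum of the `X`/`Z` strings over a coset of an even code has small expectation. -/
lemma two_mul_norm_expect_sum_sq_le {ψ : QVec n} (hψ : star ψ ⬝ᵥ ψ = 1) (hodd : Odd A.card)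
    (D : Submodule (ZMod 2) (A → ZMod 2)) (hD : ∀ d ∈ D, ∑ j, d j = 0)
    (W : Finset (A → ZMod 2)) (hW : ∀ b ∈ W, ∀ b', b' ∈ W ↔ b' - b ∈ D) :
    2 * ‖expect ψ (∑ b ∈ W, xzString A b)‖ ^ 2 ≤ 2 ^ A.card := by
  classical
  have hherm : (∑ b ∈ W, xzString A b)ᴴ = ∑ b ∈ W, xzString A b := by
    rw [conjTranspose_sum]
    simp only [xzString, pauliString_conjTranspose]
  set D' : Finset (A → ZMod 2) := Finset.univ.filter (· ∈ D) with hD'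
  set E : Finset (A → ZMod 2) := D'.filter (fun d => ∀ e ∈ D, e ⬝ᵥ d = 0) with hE
  have hshift : ∀ e ∈ D, ∀ b, b + e ∈ W ↔ b ∈ W := fun e he b => by
    constructor <;> intro hb
    · rw [hW _ hb]
      simpa using D.neg_mem he
    · rw [hW _ hb]
      simpa using he
  have hcardW : W.card ≤ D'.card := by
    rcases W.eq_empty_or_nonempty with rfl | ⟨b, hb⟩
    · simp
    · refine Finset.card_le_card_of_injOn (fun b' => b' - b) (fun b' hb' => ?_)
        (sub_left_injective.injOn)
      simpa [hD'] using (hW b hb b').mp hb'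
  choose η hη hmul using exists_xzString_mul A
  have hsq : (∑ b ∈ W, xzString A b) * (∑ b ∈ W, xzString A b) =
      ∑ d ∈ D', (η d * ∑ b ∈ W, signChar (b ⬝ᵥ d)) •
        pauliString (extendLabel A fun j => (d j, d j)) := by
    have hinner : ∀ b ∈ W, ∑ b' ∈ W, xzString A b * xzString A b' =
        ∑ d ∈ D', (η d * signChar (b ⬝ᵥ d)) •
          pauliString (extendLabel A fun j => (d j, d j)) := fun b hb => by
      simp only [← hmul]
      refine (Finset.sum_equiv (Equiv.addLeft b) (fun d => ?_) fun d _ => rfl).symm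
      simp [hD', hW b hb]
    rw [Finset.sum_mul_sum, Finset.sum_congr rfl hinner, Finset.sum_comm]
    simp only [Finset.mul_sum, Finset.sum_smul]
  have hchar : ∀ d ∈ D', ‖∑ b ∈ W, signChar (b ⬝ᵥ d)‖ ≤
      if ∀ e ∈ D, e ⬝ᵥ d = 0 then (D'.card : ℝ) else 0 := fun d _ => by
    split_ifs with h
    · refine (norm_sum_le _ _).trans ?_
      simp only [norm_signChar, Finset.sum_const, nsmul_eq_mul, mul_one]
      exact_mod_cast hcardW
    · push Not at h
      obtain ⟨e, he, hed⟩ := h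
      rw [sum_signChar_dotProduct_eq_zero (hshift e he) hed, norm_zero]
  have hbound : ‖expect ψ ((∑ b ∈ W, xzString A b) * (∑ b ∈ W, xzString A b))‖ ≤
      E.card * D'.card := by
    rw [hsq, expect_sum]
    calc _ ≤ ∑ d ∈ D', if ∀ e ∈ D, e ⬝ᵥ d = 0 then (D'.card : ℝ) else 0 := by
          refine norm_sum_le_of_le _ fun d hd => ?_
          rw [expect_smul, norm_mul, norm_mul, hη, one_mul]
          calc _ ≤ ‖∑ b ∈ W, signChar (b ⬝ᵥ d)‖ * 1 :=
                mul_le_mul_of_nonneg_left (norm_expect_pauliString_le hψ _) (norm_nonneg _)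
            _ ≤ _ := by rw [mul_one]; exact hchar d hd
      _ = _ := by rw [← Finset.sum_filter, Finset.sum_const, nsmul_eq_mul]
  have hcode := two_mul_card_mul_card_radical_le (by rwa [Fintype.card_coe]) D hD
  have hDcard : Nat.card D = D'.card := by
    rw [Nat.card_eq_fintype_card, Fintype.card_subtype]
  have hEcard : Set.ncard {d | d ∈ D ∧ ∀ e ∈ D, e ⬝ᵥ d = 0} = E.card := by
    rw [← Set.ncard_coe_finset]
    congr 1
    ext d
    simp [hE, hD']
  rw [hDcard, hEcard, Fintype.card_coe] at hcode
  have hcode' : 2 * ((D'.card : ℝ) * E.card) ≤ 2 ^ A.card := by exact_mod_cast hcode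
  have hvar := (norm_expect_sq_le hψ hherm).trans ((Complex.re_le_norm _).trans hbound)
  linarith

/-- The Hadamard expectation of a pseudo-stabilizer state on an odd number of qubits. -/
lemma IsPseudoStabilizerAt.re_expect_hadOn_le {ψ : QVec n} (hψ : star ψ ⬝ᵥ ψ = 1)
    (hodd : Odd A.card) (h : IsPseudoStabilizerAt ψ A) :
    (expect ψ (HadOn A)).re ≤ Real.sqrt 2 / 2 := by
  classical
  obtain ⟨L, hL, hcard, hstab⟩ := h.exists_lagrangian
  let xz : (A → ZMod 2) → A → ZMod 2 × ZMod 2 := fun b j => xzLabel (b j)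
  let diag : (A → ZMod 2) →ₗ[ZMod 2] (A → ZMod 2 × ZMod 2) :=
    { toFun := fun d j => (d j, d j)
      map_add' := fun _ _ => rfl
      map_smul' := fun _ _ => rfl }
  set W : Finset (A → ZMod 2) :=
    Finset.univ.filter fun b => ∀ l ∈ L, sympForm A l (xz b) = 0 with hWdef
  have hxz : ∀ b b', xz b' = xz b + diag (b' - b) := fun b b' => by
    funext j
    refine Prod.ext ?_ ?_
    · change 1 + b' j = 1 + b j + (b' j - b j)
      ring
    · change b' j = b j + (b' j - b j)
      ring
  have hperp : ∀ v, (∀ l ∈ L, sympForm A l v = 0) → v ∈ L := fun v hv => by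
    refine mem_of_orthogonal_of_card_sq _ eq_zero_of_sympForm_eq_zero L hL ?_ hv
    rw [hcard, Nat.card_eq_fintype_card, Fintype.card_fun, Fintype.card_prod, ZMod.card,
      Fintype.card_coe, mul_pow]
  have hsum : expect ψ (∑ b, xzString A b) = expect ψ (∑ b ∈ W, xzString A b) := by
    rw [expect_sum, expect_sum]
    refine (Finset.sum_subset (Finset.subset_univ W) fun b _ hb => ?_).symm
    simp only [hWdef, Finset.mem_filter, Finset.mem_univ, true_and, not_forall] at hb
    obtain ⟨l, hl, hlb⟩ := hb
    obtain ⟨m, u, hul, hu⟩ := hstab l hl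
    refine expect_pauliString_eq_zero hu ?_
    rw [sympForm_extendLabel, hul]
    exact (eq_zero_or_one_of_zmod_two _).resolve_left hlb
  have hT : 2 * ‖expect ψ (∑ b ∈ W, xzString A b)‖ ^ 2 ≤ 2 ^ A.card := by
    rcases W.eq_empty_or_nonempty with hW | ⟨b₀, hb₀⟩
    · rw [hW, Finset.sum_empty, expect, zero_mulVec, dotProduct_zero, norm_zero,
        zero_pow two_ne_zero, mul_zero]
      positivity
    have hmem : ∀ b ∈ W, ∀ l ∈ L, sympForm A l (xz b) = 0 := fun b hb =>
      (Finset.mem_filter.mp hb).2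
    refine two_mul_norm_expect_sum_sq_le hψ hodd (L.comap diag) (fun d hd => ?_) W
      fun b hb b' => ?_
    · have h0 := hL _ hd _ (hperp _ (hmem b₀ hb₀))
      rw [sympForm_apply] at h0
      rw [← h0]
      refine Finset.sum_congr rfl fun j _ => ?_
      change d j = d j * b₀ j + d j * (1 + b₀ j)
      rw [← mul_add, add_left_comm, CharTwo.add_self_eq_zero, add_zero, mul_one]
    · rw [Submodule.mem_comap, hWdef, Finset.mem_filter]
      simp only [Finset.mem_univ, true_and, hxz b b', map_add]
      constructor
      · intro hb'
        refine hperp _ fun l hl => ?_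
        simpa [hmem b hb l hl] using hb' l hl
      · intro hd l hl
        rw [hmem b hb l hl, hL l hl _ hd, add_zero]
  have hnorm : 2 * ‖expect ψ (HadOn A)‖ ^ 2 ≤ 1 := by
    rw [hadOn_eq_sum, expect_smul, hsum, norm_mul, mul_pow, norm_pow, norm_inv, Complex.norm_real,
      Real.norm_of_nonneg (Real.sqrt_nonneg 2), ← pow_mul, mul_comm A.card 2, pow_mul, inv_pow,
      Real.sq_sqrt zero_le_two, inv_pow]
    calc _ = ((2 : ℝ) ^ A.card)⁻¹ * (2 * ‖expect ψ (∑ b ∈ W, xzString A b)‖ ^ 2) := by ring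
      _ ≤ ((2 : ℝ) ^ A.card)⁻¹ * 2 ^ A.card := by gcongr
      _ = 1 := inv_mul_cancel₀ (by positivity)
  refine (Complex.re_le_norm _).trans ((le_abs_self _).trans
    (abs_le_of_sq_le_sq ?_ (by positivity)))
  rw [div_pow, Real.sq_sqrt zero_le_two]
  linarith

end EnergyBound

/-- if `ψ` is a pseudo-stabilizer state at `A` with `|A| = k` odd, then
`⟨ψ, ((I - H_A)/2) ψ⟩ ≥ sin²(π/8)`. -/
theorem pseudo_stabilizer_energy_bound (n k : ℕ) (hk : Odd k)
    (A : Finset (Fin n)) (hA : A.card = k) (ψ : QVec n) (hunit : star ψ ⬝ᵥ ψ = 1)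
    (hps : IsPseudoStabilizerAt ψ A) :
    Real.sin (Real.pi / 8) ^ 2 ≤
      (star ψ ⬝ᵥ (((2 : ℂ)⁻¹ • (1 - HadOn A)) *ᵥ ψ)).re := by
  have hsin : Real.sin (Real.pi / 8) ^ 2 = 1 / 2 - Real.sqrt 2 / 4 := by
    rw [Real.sin_sq_eq_half_sub, show 2 * (Real.pi / 8) = Real.pi / 4 by ring,
      Real.cos_pi_div_four]
    ring
  have hval : (star ψ ⬝ᵥ (((2 : ℂ)⁻¹ • (1 - HadOn A)) *ᵥ ψ)).re =
      1 / 2 - (expect ψ (HadOn A)).re / 2 := by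
    change (expect ψ _).re = _
    rw [expect_smul, expect_sub, expect_one hunit,
      show (2 : ℂ)⁻¹ = ((2⁻¹ : ℝ) : ℂ) by push_cast; rfl, Complex.re_ofReal_mul, Complex.sub_re,
      Complex.one_re]
    ring
  have hle := hps.re_expect_hadOn_le hunit (hA ▸ hk)
  rw [hsin, hval]
  linarith
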